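/- arXiv:1412.6083 — 2 statements merged into one kernel-verified Lean document; each statement's English description precedes it below -/
import Mathlib

section
/- Let R = M_m(F_q) be the ring of m × m matrices over the finite field F_q and A a finite left R-module. Then A has the extension property with respect to the symmetrized weight composition built on Aut_R(A) if and only if A has the extension property with respect to Hamming weight. -/
open Function

/-- The annihilator of an element `a` of a left `R`-module, as a left ideal of `R`. -/
def elemAnn (R : Type*) [Ring R] {A : Type*} [AddCommGroup A] [Module R A] (a : A) :
    Submodule R R where
  carrier := {r | r • a = 0}
  add_mem' := fun {x y} hx hy => by
    simp only [Set.mem_setOf_eq] at *; rw [add_smul, hx, hy, add_zero]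
  zero_mem' := by simp
  smul_mem' := fun c r hr => by
    simp only [Set.mem_setOf_eq, smul_eq_mul] at *
    rw [mul_smul, hr, smul_zero]

/-- The symmetrized weight composition built on a subgroup `G ≤ Aut_R(A)`. -/
noncomputable def swc (R : Type*) [Ring R] {A : Type*} [AddCommGroup A] [Module R A]
    (G : Subgroup (A ≃ₗ[R] A)) {n : ℕ} (x : Fin n → A) (a : A) : ℕ :=
  Nat.card {i : Fin n // ∃ τ ∈ G, x i = τ a}

/-- The Hamming weight of a word. -/
noncomputable def hwt {A : Type*} [Zero A] {n : ℕ} (x : Fin n → A) : ℕ :=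
  Nat.card {i : Fin n // x i ≠ 0}

/-- The annihilator weight of a word. -/
noncomputable def aw (R : Type*) [Ring R] {A : Type*} [AddCommGroup A] [Module R A]
    {n : ℕ} (x : Fin n → A) (a : A) : ℕ :=
  Nat.card {i : Fin n // elemAnn R (x i) = elemAnn R a}

/-- `f : C → A^n` is the restriction of a `G`-monomial transformation of `A^n`. -/
def ExtendsToMonomial (R : Type*) [Ring R] {A : Type*} [AddCommGroup A] [Module R A]
    (G : Subgroup (A ≃ₗ[R] A)) {n : ℕ} (C : Submodule R (Fin n → A))
    (f : C →ₗ[R] (Fin n → A)) : Prop :=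
  ∃ (σ : Equiv.Perm (Fin n)) (τ : Fin n → G),
    ∀ (x : C) (i : Fin n), f x i = (τ i : A ≃ₗ[R] A) ((x : Fin n → A) (σ i))

/-- The extension property with respect to the symmetrized weight composition built on `G`. -/
def HasEPswc (R : Type*) [Ring R] (A : Type*) [AddCommGroup A] [Module R A]
    (G : Subgroup (A ≃ₗ[R] A)) : Prop :=
  ∀ (n : ℕ) (C : Submodule R (Fin n → A)) (f : C →ₗ[R] (Fin n → A)),
    Injective f → (∀ (x : C) (a : A), swc R G (f x) a = swc R G (x : Fin n → A) a) →
    ExtendsToMonomial R G C f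

/-- The extension property with respect to the Hamming weight. -/
def HasEPHamming (R : Type*) [Ring R] (A : Type*) [AddCommGroup A] [Module R A] : Prop :=
  ∀ (n : ℕ) (C : Submodule R (Fin n → A)) (f : C →ₗ[R] (Fin n → A)),
    Injective f → (∀ x : C, hwt (f x) = hwt (x : Fin n → A)) →
    ExtendsToMonomial R (⊤ : Subgroup (A ≃ₗ[R] A)) C f

/-- The extension property with respect to the annihilator weight. -/
def HasEPaw (R : Type*) [Ring R] (A : Type*) [AddCommGroup A] [Module R A] : Prop :=
  ∀ (n : ℕ) (C : Submodule R (Fin n → A)) (f : C →ₗ[R] (Fin n → A)),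
    Injective f → (∀ (x : C) (a : A), aw R (f x) a = aw R (x : Fin n → A) a) →
    ExtendsToMonomial R (⊤ : Subgroup (A ≃ₗ[R] A)) C f

/-- A module is pseudo-injective if every injective linear map from a submodule into the
module extends to an endomorphism. -/
def PseudoInjective (R : Type*) [Ring R] (A : Type*) [AddCommGroup A] [Module R A] : Prop :=
  ∀ (B : Submodule R A) (g : B →ₗ[R] A), Injective g →
    ∃ h : A →ₗ[R] A, ∀ b : B, h b = g b

/-- `A` embeds, as a left `R`-module, into the character module
`R̂ = Hom((R,+), ℚ/ℤ)` with `(r • χ) x = χ (x * r)`. -/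
def EmbedsInCharacterModule (R : Type*) [Ring R] (A : Type*) [AddCommGroup A]
    [Module R A] : Prop :=
  ∃ ι : A →+ (R →+ AddCircle (1 : ℚ)),
    Injective ι ∧ ∀ (r : R) (a : A) (x : R), ι (r • a) x = ι a (x * r)

/-- A chain ring: the left ideals are linearly ordered by inclusion. -/
def IsChainRing (R : Type*) [Ring R] : Prop :=
  ∀ I J : Submodule R R, I ≤ J ∨ J ≤ I

/-- Two finite families in a finite partial order with equally many members above each element
take each value equally often. -/
theorem card_fiber_eq_of_card_ge_eq {ι L : Type*} [Finite ι] [PartialOrder L] [Finite L]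
    (u v : ι → L) (h : ∀ I, Nat.card {i // I ≤ u i} = Nat.card {i // I ≤ v i}) (I : L) :
    Nat.card {i // u i = I} = Nat.card {i // v i = I} := by
  classical
  have := Fintype.ofFinite ι
  have := Fintype.ofFinite L
  have split (w : ι → L) (I : L) : Nat.card {i // I ≤ w i} =
      Nat.card {i // w i = I} + ∑ J with I < J, Nat.card {i // w i = J} := by
    have hI : I ∉ Finset.univ.filter (I < ·) := by simp
    rw [← Finset.sum_insert (f := fun J => Nat.card {i // w i = J}) hI]
    simp only [Nat.card_eq_fintype_card, Fintype.card_subtype]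
    rw [Finset.card_eq_sum_card_fiberwise (f := w) (t := insert I (Finset.univ.filter (I < ·)))]
    · refine Finset.sum_congr rfl fun J hJ => ?_
      rw [Finset.filter_filter]
      congr 1
      ext i
      simp only [Finset.mem_filter, Finset.mem_univ, true_and, and_iff_right_iff_imp]
      rintro rfl
      simp only [Finset.mem_insert, Finset.mem_filter, Finset.mem_univ, true_and] at hJ
      exact hJ.elim (fun h => h.ge) le_of_lt
    · intro i hi
      simpa [eq_comm, le_iff_eq_or_lt] using hi
  induction I using WellFoundedGT.induction with
  | ind I ih =>
    have key := h I
    rw [split u, split v, Finset.sum_congr rfl fun J hJ => ih J (Finset.mem_filter.1 hJ).2] at key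
    exact Nat.add_right_cancel key

theorem mem_elemAnn {R A : Type*} [Ring R] [AddCommGroup A] [Module R A] {a : A} {r : R} :
    r ∈ elemAnn R a ↔ r • a = 0 :=
  Iff.rfl

theorem elemAnn_apply_equiv {R A : Type*} [Ring R] [AddCommGroup A] [Module R A]
    (τ : A ≃ₗ[R] A) (a : A) : elemAnn R (τ a) = elemAnn R a := by
  ext r
  rw [mem_elemAnn, mem_elemAnn, ← map_smul, τ.map_eq_zero_iff]

/-- Submodules of equal cardinality in a finite isotypic module over a semisimple ring are
isomorphic. -/
theorem IsIsotypic.nonempty_linearEquiv_of_card_eq {R A : Type*} [Ring R] [IsSemisimpleRing R]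
    [AddCommGroup A] [Finite A] [Module R A] (h : IsIsotypic R A) (C D : Submodule R A)
    (hCD : Nat.card C = Nat.card D) : Nonempty (C ≃ₗ[R] D) := by
  rcases subsingleton_or_nontrivial A with hA | hA
  · rw [Subsingleton.elim C D]
    exact ⟨.refl R D⟩
  obtain ⟨S, hS⟩ := IsAtomic.exists_atom (Submodule R A)
  rw [← isSimpleModule_iff_isAtom] at hS
  have := IsSimpleModule.nontrivial R S
  obtain ⟨c, ⟨eC⟩⟩ := ((h S).of_injective C.subtype C.subtype_injective).linearEquiv_fun
  obtain ⟨d, ⟨eD⟩⟩ := ((h S).of_injective D.subtype D.subtype_injective).linearEquiv_fun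
  rw [Nat.card_congr eC.toEquiv, Nat.card_congr eD.toEquiv, Nat.card_fun, Nat.card_fun,
    Nat.card_fin, Nat.card_fin] at hCD
  obtain rfl := Nat.pow_right_injective Finite.one_lt_card hCD
  exact ⟨eC.trans eD.symm⟩

/-- In a finite isotypic module over a semisimple ring, elements with the same annihilator are
conjugate under automorphisms. -/
theorem IsIsotypic.exists_equiv_apply_eq_of_elemAnn_eq {R A : Type*} [Ring R]
    [IsSemisimpleRing R] [AddCommGroup A] [Finite A] [Module R A] (h : IsIsotypic R A) {a b : A}
    (hab : elemAnn R a = elemAnn R b) : ∃ τ : A ≃ₗ[R] A, a = τ b := by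
  let p (x : A) : R →ₗ[R] A := LinearMap.toSpanSingleton R A x
  have hp (x : A) : LinearMap.ker (p x) = elemAnn R x := by
    ext r
    simp [p, mem_elemAnn]
  have hker : LinearMap.ker (p b) = LinearMap.ker (p a) := by rw [hp, hp, hab]
  let e : LinearMap.range (p b) ≃ₗ[R] LinearMap.range (p a) :=
    (p b).quotKerEquivRange.symm ≪≫ₗ Submodule.quotEquivOfEq _ _ hker ≪≫ₗ
      (p a).quotKerEquivRange
  have hb : b ∈ LinearMap.range (p b) := ⟨1, by simp [p]⟩
  have he : (e ⟨b, hb⟩ : A) = a := by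
    have : (⟨b, hb⟩ : LinearMap.range (p b)) =
        (p b).quotKerEquivRange (Submodule.Quotient.mk 1) := by
      ext
      simp [p]
    simp [e, this, p]
  obtain ⟨D, hD⟩ := exists_isCompl (LinearMap.range (p b))
  obtain ⟨C, hC⟩ := exists_isCompl (LinearMap.range (p a))
  have cardD := Nat.card_congr (Submodule.prodEquivOfIsCompl _ _ hD).toEquiv
  have cardC := Nat.card_congr (Submodule.prodEquivOfIsCompl _ _ hC).toEquiv
  rw [Nat.card_prod] at cardD cardC
  rw [Nat.card_congr e.toEquiv, ← cardC] at cardD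
  obtain ⟨e'⟩ := h.nonempty_linearEquiv_of_card_eq D C
    (Nat.eq_of_mul_eq_mul_left Nat.card_pos cardD)
  refine ⟨(Submodule.prodEquivOfIsCompl _ _ hD).symm ≪≫ₗ e.prodCongr e' ≪≫ₗ
    Submodule.prodEquivOfIsCompl _ _ hC, ?_⟩
  have hb' : (Submodule.prodEquivOfIsCompl _ _ hD).symm b = (⟨b, hb⟩, 0) :=
    Submodule.prodEquivOfIsCompl_symm_apply_left _ _ hD ⟨b, hb⟩
  simp [hb', he]

/-- Over a finite isotypic module, the symmetrized weight composition built on the full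
automorphism group is the annihilator weight. -/
theorem IsIsotypic.swc_top_eq_aw {R A : Type*} [Ring R] [IsSemisimpleRing R] [AddCommGroup A]
    [Finite A] [Module R A] (h : IsIsotypic R A) {n : ℕ} (x : Fin n → A) (a : A) :
    swc R ⊤ x a = aw R x a := by
  refine Nat.card_congr (Equiv.subtypeEquivRight fun i => ⟨?_, fun hi => ?_⟩)
  · rintro ⟨τ, -, hτ⟩
    rw [hτ, elemAnn_apply_equiv]
  · obtain ⟨τ, hτ⟩ := h.exists_equiv_apply_eq_of_elemAnn_eq hi
    exact ⟨τ, trivial, hτ⟩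

theorem hwt_add_card_eq_zero {A : Type*} [Zero A] {n : ℕ} (x : Fin n → A) :
    hwt x + Nat.card {i // x i = 0} = n := by
  classical
  have := Fintype.card_subtype_compl (fun i => x i = 0)
  have hle := Fintype.card_subtype_le (fun i => x i = 0)
  simp only [hwt, Nat.card_eq_fintype_card, ne_eq, Fintype.card_fin] at *
  omega

theorem swc_zero {R A : Type*} [Ring R] [AddCommGroup A] [Module R A]
    (G : Subgroup (A ≃ₗ[R] A)) {n : ℕ} (x : Fin n → A) :
    swc R G x 0 = Nat.card {i // x i = 0} := by
  refine Nat.card_congr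
    (Equiv.subtypeEquivRight fun i => ⟨?_, fun hi => ⟨1, G.one_mem, by simp [hi]⟩⟩)
  rintro ⟨τ, -, hτ⟩
  rw [hτ, map_zero]

/-- Over a finite principal left ideal ring, linear maps preserving the Hamming weight preserve
the annihilator weight. -/
theorem aw_eq_of_hwt_eq {R A : Type*} [Ring R] [Finite R] [IsPrincipalIdealRing R]
    [AddCommGroup A] [Module R A] {n : ℕ} {C : Submodule R (Fin n → A)}
    (f : C →ₗ[R] (Fin n → A)) (hf : ∀ x : C, hwt (f x) = hwt (x : Fin n → A)) (x : C) (a : A) :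
    aw R (f x) a = aw R (x : Fin n → A) a := by
  refine card_fiber_eq_of_card_ge_eq (fun i => elemAnn R (f x i))
    (fun i => elemAnn R ((x : Fin n → A) i)) (fun I => ?_) _
  obtain ⟨r, rfl⟩ := IsPrincipalIdealRing.principal I
  have h₁ := hwt_add_card_eq_zero (f (r • x))
  have h₂ := hwt_add_card_eq_zero ((r • x : C) : Fin n → A)
  have := hf (r • x)
  simp only [Submodule.span_singleton_le_iff_mem, mem_elemAnn]
  simp only [map_smul, Submodule.coe_smul, Pi.smul_apply] at h₁ h₂ this
  omega

theorem isIsotypic_matrix (F : Type*) [Field F] (m : ℕ) (A : Type*) [AddCommGroup A]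
    [Module (Matrix (Fin m) (Fin m) F) A] : IsIsotypic (Matrix (Fin m) (Fin m) F) A := by
  rcases m.eq_zero_or_pos with rfl | hm
  · have := Module.subsingleton (Matrix (Fin 0) (Fin 0) F) A
    exact .of_subsingleton _ _
  · have : NeZero m := ⟨hm.ne'⟩
    exact IsSimpleRing.isIsotypic _ _

/-- For a finite left module `A` over the matrix ring `M_m(F_q)`, the extension property with
respect to the symmetrized weight composition built on `Aut_R(A)` holds iff the extension
property with respect to Hamming weight holds. -/
theorem ep_swc_iff_ep_hamming_of_matrixRing
    (F : Type*) [Field F] [Fintype F] (m : ℕ)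
    (A : Type*) [AddCommGroup A] [Finite A] [Module (Matrix (Fin m) (Fin m) F) A] :
    HasEPswc (Matrix (Fin m) (Fin m) F) A (⊤ : Subgroup (A ≃ₗ[Matrix (Fin m) (Fin m) F] A)) ↔
      HasEPHamming (Matrix (Fin m) (Fin m) F) A := by
  have : Finite (Matrix (Fin m) (Fin m) F) := inferInstanceAs (Finite (Fin m → Fin m → F))
  constructor
  · intro h n C f hinj hf
    refine h n C f hinj fun x a => ?_
    rw [(isIsotypic_matrix F m A).swc_top_eq_aw, (isIsotypic_matrix F m A).swc_top_eq_aw]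
    exact aw_eq_of_hwt_eq f hf x a
  · intro h n C f hinj hf
    refine h n C f hinj fun x => ?_
    have h₀ := hf x 0
    rw [swc_zero, swc_zero] at h₀
    have h₁ := hwt_add_card_eq_zero (f x)
    have h₂ := hwt_add_card_eq_zero (x : Fin n → A)
    omega
end

section
/- Let R be a finite ring with unity and A a finite left R-module. Then A has the extension property with respect to the symmetrized weight composition built on Aut_R(A) if and only if A can be embedded in the character module R̂ as a left R-module. -/
open Function

/-- Two families on a finite index type whose fibres have the same sizes differ by a permutation. -/
lemma exists_perm_of_card_fiber_eq {I X : Type*} [Finite I] (u v : I → X)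
    (h : ∀ q, Nat.card {i // u i = q} = Nat.card {i // v i = q}) :
    ∃ σ : Equiv.Perm I, ∀ i, u i = v (σ i) := by
  have e : ∀ q, Nonempty ({i // u i = q} ≃ {i // v i = q}) := fun q =>
    Finite.card_eq.1 (h q)
  exact ⟨Equiv.ofFiberEquiv fun q => (e q).some, fun i => (Equiv.ofFiberEquiv_map _ i).symm⟩

/-- The canonical additive character of `ℚ/ℤ` with complex values. -/
noncomputable def ratCircleChar : AddChar (AddCircle (1 : ℚ)) ℂ :=
  (Circle.coeHom.compAddChar (AddCircle.toCircle_addChar (T := (1 : ℝ)))).compAddMonoidHom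
    (QuotientAddGroup.map (AddSubgroup.zmultiples (1 : ℚ)) (AddSubgroup.zmultiples (1 : ℝ))
      (Rat.castHom ℝ).toAddMonoidHom (by
        rintro _ ⟨k, rfl⟩
        exact ⟨k, by simp⟩))

lemma ratCircleChar_eq_one_iff (x : AddCircle (1 : ℚ)) : ratCircleChar x = 1 ↔ x = 0 := by
  refine ⟨fun h => ?_, fun h => by simp [h]⟩
  induction x using QuotientAddGroup.induction_on with | H q => ?_
  have h₁ : AddCircle.toCircle (((q : ℝ) : AddCircle (1 : ℝ))) = 1 := Circle.ext h
  rw [← AddCircle.toCircle_zero] at h₁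
  have h₂ := AddCircle.injective_toCircle one_ne_zero h₁
  rw [AddCircle.coe_eq_zero_iff] at h₂
  obtain ⟨k, hk⟩ := h₂
  refine (AddCircle.coe_eq_zero_iff 1).2 ⟨k, ?_⟩
  have : (k : ℝ) = q := by simpa using hk
  simpa using (by exact_mod_cast this : (k : ℚ) = q)

section

variable {R : Type*} [Ring R] {A : Type*} [AddCommGroup A] [Module R A]
  (G : Subgroup (A ≃ₗ[R] A))

lemma swc_eq_card_orbit {n : ℕ} (x : Fin n → A) (a : A) :
    swc R G x a = Nat.card {i // (Quotient.mk _ (x i) : MulAction.orbitRel.Quotient G A) =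
      Quotient.mk _ a} := by
  refine Nat.card_congr (Equiv.subtypeEquivRight fun i => ?_)
  rw [Quotient.eq, MulAction.orbitRel_apply]
  constructor
  · rintro ⟨τ, hτ, h⟩
    exact ⟨⟨τ, hτ⟩, h.symm⟩
  · rintro ⟨τ, h⟩
    exact ⟨τ, τ.2, h.symm⟩

/-- Words with the same symmetrized weight composition agree up to a permutation of the
coordinates and the action of `G` on each of them. -/
lemma exists_perm_of_swc_eq {n : ℕ} {x y : Fin n → A} (h : ∀ a, swc R G x a = swc R G y a) :
    ∃ σ : Equiv.Perm (Fin n), ∀ i, ∃ g : G, g • y (σ i) = x i := by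
  obtain ⟨σ, hσ⟩ := exists_perm_of_card_fiber_eq
    (fun i => (Quotient.mk _ (x i) : MulAction.orbitRel.Quotient G A))
    (fun i => (Quotient.mk _ (y i) : MulAction.orbitRel.Quotient G A)) (by
      intro q
      induction q using Quotient.inductionOn with | h a => ?_
      rw [← swc_eq_card_orbit, ← swc_eq_card_orbit, h])
  exact ⟨σ, fun i => Quotient.exact (hσ i)⟩

lemma swc_zero_eq_iff {n : ℕ} (x : Fin n → A) : swc R G x 0 = n ↔ x = 0 := by
  have h : swc R G x 0 = Nat.card {i // x i = 0} :=
    Nat.card_congr (Equiv.subtypeEquivRight fun i =>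
      ⟨fun ⟨τ, _, h⟩ => by simpa using h, fun h => ⟨1, G.one_mem, by simpa using h⟩⟩)
  classical
  rw [h, Nat.card_eq_fintype_card, Fintype.card_subtype, funext_iff]
  simpa using Finset.card_filter_eq_iff (s := Finset.univ) (p := fun i => x i = 0)

/-- If some character of `A` has no nonzero submodule in its kernel, then every linear map
preserving the symmetrized weight composition built on `G` extends to a `G`-monomial
transformation. -/
theorem extendsToMonomial_of_swc_eq [Finite A] (ρ : A →+ AddCircle (1 : ℚ))
    (hρ : ∀ a, (∀ r : R, ρ (r • a) = 0) → a = 0) {n : ℕ} (C : Submodule R (Fin n → A))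
    (f : C →ₗ[R] (Fin n → A))
    (hf : ∀ (x : C) (a : A), swc R G (f x) a = swc R G (x : Fin n → A) a) :
    ExtendsToMonomial R G C f := by
  classical
  have : Finite (A ≃ₗ[R] A) := DFunLike.finite _
  have := Fintype.ofFinite G
  let χ : (C →ₗ[R] A) → AddChar C ℂ := fun μ =>
    ratCircleChar.compAddMonoidHom (ρ.comp μ.toAddMonoidHom)
  have hχ (μ : C →ₗ[R] A) (x : C) : χ μ x = ratCircleChar (ρ (μ x)) := rfl
  have χ_inj : Injective χ := by
    intro μ ν h
    ext x
    refine sub_eq_zero.1 (hρ _ fun r => (ratCircleChar_eq_one_iff _).1 ?_)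
    rw [smul_sub, map_sub, ← map_smul, ← map_smul, AddChar.map_sub_eq_div, ← hχ, ← hχ, h,
      div_self ((χ ν).val_isUnit _).ne_zero]
  have indep : LinearIndependent ℂ fun μ : C →ₗ[R] A => (χ μ : C → ℂ) :=
    (AddChar.linearIndependent C ℂ).comp χ χ_inj
  let u : Fin n → (C →ₗ[R] A) := fun i => LinearMap.proj i ∘ₗ f
  let v : Fin n → (C →ₗ[R] A) := fun i => LinearMap.proj i ∘ₗ C.subtype
  have sum_eq (x : C) : ∑ i, ∑ g : G, ratCircleChar (ρ (g • f x i)) =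
      ∑ i, ∑ g : G, ratCircleChar (ρ (g • (x : Fin n → A) i)) := by
    obtain ⟨σ, hσ⟩ := exists_perm_of_swc_eq G (hf x)
    rw [← Equiv.sum_comp σ fun i => ∑ g : G, ratCircleChar (ρ (g • (x : Fin n → A) i))]
    refine Finset.sum_congr rfl fun i _ => ?_
    obtain ⟨g₀, h₀⟩ := hσ i
    rw [← h₀]
    simp_rw [smul_smul]
    exact Equiv.sum_comp (Equiv.mulRight g₀)
      fun g => ratCircleChar (ρ (g • (x : Fin n → A) (σ i)))
  have orbit_sum : ∑ i, ∑ g : G, Finsupp.single (g • u i) (1 : ℂ) =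
      ∑ i, ∑ g : G, Finsupp.single (g • v i) (1 : ℂ) := by
    apply indep
    ext x
    simpa [Finsupp.linearCombination_single, hχ, u, v] using sum_eq x
  let q : (C →ₗ[R] A) → MulAction.orbitRel.Quotient G (C →ₗ[R] A) := Quotient.mk _
  have hq (g : G) (μ : C →ₗ[R] A) : q (g • μ) = q μ := Quotient.sound ⟨g, rfl⟩
  have class_sum := congrArg (Finsupp.mapDomain q) orbit_sum
  simp only [Finsupp.mapDomain_finsetSum, Finsupp.mapDomain_single, hq, Finset.sum_const,
    ← Finset.smul_sum, Finset.card_univ] at class_sum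
  have class_sum' := smul_right_injective _ (Fintype.card_ne_zero (α := G)) class_sum
  obtain ⟨σ, hσ⟩ := exists_perm_of_card_fiber_eq (fun i => q (u i)) (fun i => q (v i)) (by
    intro c
    have := DFunLike.congr_fun class_sum' c
    simp only [Finsupp.finsetSum_apply, Finsupp.single_apply, Finset.sum_boole] at this
    simpa [Nat.card_eq_fintype_card, Fintype.card_subtype] using this)
  have hτ (i : Fin n) : ∃ g : G, g • v (σ i) = u i := Quotient.exact (hσ i)
  choose τ hτ using hτ
  exact ⟨σ, τ, fun x i => (LinearMap.congr_fun (hτ i) x).symm⟩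

variable {G}

/-- The extension property in terms of families of linear functionals. -/
theorem HasEPswc.exists_perm (hA : HasEPswc R A G) {M : Type*} [AddCommGroup M] [Module R M]
    {n : ℕ} (u v : Fin n → (M →ₗ[R] A))
    (h : ∀ x a, swc R G (fun i => u i x) a = swc R G (fun i => v i x) a) :
    ∃ (σ : Equiv.Perm (Fin n)) (τ : Fin n → G), ∀ i x, u i x = τ i • v (σ i) x := by
  have hker (x : M) : LinearMap.pi u x = 0 ↔ LinearMap.pi v x = 0 := by
    rw [← swc_zero_eq_iff G, ← swc_zero_eq_iff G]
    exact Eq.congr_left (h x 0)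
  let V := LinearMap.pi v
  let f : V.range →ₗ[R] (Fin n → A) :=
    V.ker.liftQ (LinearMap.pi u) (fun x hx => (hker x).2 hx) ∘ₗ V.quotKerEquivRange.symm
  have hf (x : M) : f ⟨V x, x, rfl⟩ = LinearMap.pi u x := by
    have : V.quotKerEquivRange.symm ⟨V x, x, rfl⟩ = Submodule.Quotient.mk x :=
      (LinearEquiv.symm_apply_eq _).2 rfl
    simp only [f, LinearMap.comp_apply, LinearEquiv.coe_coe, this]
    exact Submodule.liftQ_apply _ _ _
  obtain ⟨σ, τ, hστ⟩ := hA n V.range f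
    ((injective_iff_map_eq_zero f).2 (by
      rintro ⟨_, x, rfl⟩ hx
      rw [hf, hker] at hx
      exact Subtype.ext hx))
    (by
      rintro ⟨_, x, rfl⟩ a
      rw [hf]
      exact h x a)
  refine ⟨σ, τ, fun i x => ?_⟩
  have := hστ ⟨V x, x, rfl⟩ i
  rw [hf] at this
  exact this

/-- Under the extension property, an integral weight on tuples `J → A` that is balanced on each
`G`-orbit along every linear form vanishes at the zero tuple. -/
theorem HasEPswc.weight_zero_eq [Finite A] (hA : HasEPswc R A G) {J : Type*} [Fintype J]
    (p q : (J → A) → ℕ)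
    (h : ∀ (r : J → R) (a : A), ∑ᶠ l : {l : J → A // ∃ τ ∈ G, ∑ j, r j • l j = τ a}, p l =
      ∑ᶠ l : {l : J → A // ∃ τ ∈ G, ∑ j, r j • l j = τ a}, q l) : p 0 = q 0 := by
  classical
  have := Fintype.ofFinite A
  have card_filter (p : (J → A) → ℕ) (P : (J → A) → Prop) :
      Nat.card {i : (l : J → A) × Fin (p l) // P i.1} = ∑ᶠ l : {l // P l}, p l := by
    rw [finsum_eq_sum_of_fintype]
    rw [Nat.card_congr (Equiv.subtypeSigmaEquiv (fun l => Fin (p l)) P), Nat.card_sigma]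
    simp
  have htot : Nat.card ((l : J → A) × Fin (p l)) = Nat.card ((l : J → A) × Fin (q l)) := by
    have := h 0 0
    rw [← card_filter, ← card_filter] at this
    rwa [Nat.card_congr (Equiv.subtypeUnivEquiv fun i => ⟨1, G.one_mem, by simp⟩),
      Nat.card_congr (Equiv.subtypeUnivEquiv fun i => ⟨1, G.one_mem, by simp⟩)] at this
  obtain ⟨n, hn⟩ : ∃ n, n = Nat.card ((l : J → A) × Fin (p l)) := ⟨_, rfl⟩
  have eP := (Finite.equivFinOfCardEq hn.symm).symm
  have eQ := (Finite.equivFinOfCardEq (htot.symm.trans hn.symm)).symm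
  have swc_eq (p : (J → A) → ℕ) (e : Fin n ≃ (l : J → A) × Fin (p l)) (r : J → R) (a : A) :
      swc R G (fun i => Fintype.linearCombination R (e i).1 r) a =
        ∑ᶠ l : {l : J → A // ∃ τ ∈ G, ∑ j, r j • l j = τ a}, p l := by
    rw [← card_filter]
    exact Nat.card_congr (e.subtypeEquiv fun i => Iff.rfl)
  obtain ⟨σ, τ, hστ⟩ := hA.exists_perm
    (fun i => Fintype.linearCombination R (eP i).1)
    (fun i => Fintype.linearCombination R (eQ i).1) (fun r a => by rw [swc_eq, swc_eq, h])
  have card_zero (p : (J → A) → ℕ) (e : Fin n ≃ (l : J → A) × Fin (p l)) :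
      Nat.card {i // (e i).1 = 0} = p 0 := by
    rw [Nat.card_congr (e.subtypeEquiv (q := fun i => i.1 = 0) fun i => Iff.rfl),
      card_filter p fun l => l = 0, finsum_unique]
    rfl
  rw [← card_zero p eP, ← card_zero q eQ]
  refine Nat.card_congr (σ.subtypeEquiv fun i => ?_)
  have apply_single (l : J → A) (j : J) :
      Fintype.linearCombination R l (Pi.single j 1) = l j := by simp
  have hi (j : J) : (eP i).1 j = τ i • (eQ (σ i)).1 j := by
    rw [← apply_single (eP i).1, hστ, apply_single]
  simp [funext_iff, hi, smul_eq_zero_iff_eq]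

/-- Under the extension property, any finite tuple of characters of `A` is obtained from a single
character by scalar multiplications. -/
theorem HasEPswc.exists_common_character [Finite A] (hA : HasEPswc R A G)
    {J : Type*} [Fintype J] (ρ : J → (A →+ AddCircle (1 : ℚ))) :
    ∃ (ψ : A →+ AddCircle (1 : ℚ)) (r : J → R), ∀ j a, ρ j a = ψ (r j • a) := by
  classical
  have := Fintype.ofFinite A
  let χ : (J → A) →+ AddCircle (1 : ℚ) := ∑ j, (ρ j).comp (Pi.evalAddMonoidHom _ j)
  have hχ (l : J → A) : χ l = ∑ j, ρ j (l j) := by simp [χ]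
  let s (r : J → R) : (J → A) →+ A :=
    ∑ j, (DistribSMul.toAddMonoidHom A (r j)).comp (Pi.evalAddMonoidHom _ j)
  have hs (r : J → R) (l : J → A) : s r l = ∑ j, r j • l j := by simp [s]
  obtain ⟨r, hr⟩ : ∃ r, (s r).ker ≤ χ.ker := by
    by_contra! hno
    have char_sum (r : J → R) (a : A) :
        ∑ l : {l : J → A // ∃ τ ∈ G, ∑ j, r j • l j = τ a}, ratCircleChar (χ l) = 0 := by
      obtain ⟨l₀, h₀, h₀'⟩ := SetLike.not_le_iff_exists.1 (hno r)
      have hne : ratCircleChar (χ l₀) ≠ 1 := fun h => h₀' ((ratCircleChar_eq_one_iff _).1 h)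
      have hz : ∑ j, r j • l₀ j = 0 := by rw [← hs]; exact h₀
      let e : {l : J → A // ∃ τ ∈ G, ∑ j, r j • l j = τ a} ≃
          {l : J → A // ∃ τ ∈ G, ∑ j, r j • l j = τ a} :=
        (Equiv.addLeft l₀).subtypeEquiv fun l => by
          simp [smul_add, Finset.sum_add_distrib, hz]
      have := Equiv.sum_comp e fun l => ratCircleChar (χ l)
      simp only [e, Equiv.subtypeEquiv_apply, Equiv.coe_addLeft, map_add,
        AddChar.map_add_eq_mul, ← Finset.mul_sum] at this
      exact (mul_left_eq_self₀.1 this).resolve_left hne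
    obtain ⟨φ, hφ⟩ := (Algebra.linearMap ℚ ℂ).exists_leftInverse_of_injective
      (LinearMap.ker_eq_bot.2 (algebraMap ℚ ℂ).injective)
    obtain ⟨d, hd⟩ := IsLocalization.exist_integer_multiples_of_finite (nonZeroDivisors ℤ)
      fun l : J → A => φ (ratCircleChar (χ l))
    choose w hw using hd
    have w_sum (r : J → R) (a : A) :
        ∑ l : {l : J → A // ∃ τ ∈ G, ∑ j, r j • l j = τ a}, w l = 0 := by
      apply (algebraMap ℤ ℚ).injective_int
      simp only [map_sum, map_zero, hw]
      rw [← Finset.smul_sum, ← map_sum,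
        char_sum, map_zero, smul_zero]
    have w_zero : w 0 ≠ 0 := by
      intro h
      have h₀ := hw 0
      have h₁ : φ 1 = 1 := by simpa using LinearMap.congr_fun hφ 1
      rw [h, map_zero, map_zero, AddChar.map_zero_eq_one, h₁] at h₀
      have hd₀ : ((d : ℤ) : ℚ) = 0 := by simpa [Submonoid.smul_def] using h₀.symm
      exact nonZeroDivisors.coe_ne_zero d (by exact_mod_cast hd₀)
    have := hA.weight_zero_eq (fun l => (w l).toNat) (fun l => (-w l).toNat) fun r a => by
      rw [finsum_eq_sum_of_fintype, finsum_eq_sum_of_fintype]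
      have := w_sum r a
      zify
      rw [← sub_eq_zero, ← Finset.sum_sub_distrib, ← this]
      exact Finset.sum_congr rfl fun l _ => by grind
    omega
  obtain ⟨ψ, hψ⟩ := CharacterModule.dual_surjective_of_injective (R := ℤ)
    (QuotientAddGroup.kerLift (s r)).toIntLinearMap (QuotientAddGroup.kerLift_injective (s r))
    (QuotientAddGroup.lift (s r).ker χ hr)
  refine ⟨ψ, r, fun j a => ?_⟩
  have h := DFunLike.congr_fun hψ (QuotientAddGroup.mk (Pi.single j a))
  have h₁ : χ (Pi.single j a) = ρ j a := by
    rw [hχ, Finset.sum_eq_single j (fun k _ hk => by simp [hk]) (by simp), Pi.single_eq_same]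
  have h₂ : s r (Pi.single j a) = r j • a := by
    rw [hs, Finset.sum_eq_single j (fun k _ hk => by simp [hk]) (by simp), Pi.single_eq_same]
  rw [← h₁, ← h₂]
  exact h.symm

theorem HasEPswc.embedsInCharacterModule [Finite A] (hA : HasEPswc R A G) :
    EmbedsInCharacterModule R A := by
  have := Fintype.ofFinite A
  have sep (b : A) : ∃ c : A →+ AddCircle (1 : ℚ), b ≠ 0 → c b ≠ 0 := by
    by_cases hb : b = 0
    · exact ⟨0, fun h => absurd hb h⟩
    · obtain ⟨c, hc⟩ := CharacterModule.exists_character_apply_ne_zero_of_ne_zero hb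
      exact ⟨c, fun _ => hc⟩
  choose ρ hρ using sep
  obtain ⟨ψ, r, h⟩ := hA.exists_common_character ρ
  let ι : A →+ (R →+ AddCircle (1 : ℚ)) :=
    AddMonoidHom.mk' (fun a => ψ.comp ((smulAddHom R A).flip a)) fun a b => by ext; simp
  have hι (a : A) (x : R) : ι a x = ψ (x • a) := rfl
  refine ⟨ι, (injective_iff_map_eq_zero ι).2 fun a ha => ?_, fun r a x => ?_⟩
  · by_contra hne
    refine hρ a hne ?_
    rw [h, ← hι, ha, AddMonoidHom.zero_apply]
  · rw [hι, hι, smul_smul]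

theorem EmbedsInCharacterModule.hasEPswc [Finite A] (h : EmbedsInCharacterModule R A)
    (G : Subgroup (A ≃ₗ[R] A)) : HasEPswc R A G := by
  obtain ⟨ι, hinj, hι⟩ := h
  intro n C f _ hf
  refine extendsToMonomial_of_swc_eq G ((AddMonoidHom.eval (1 : R)).comp ι) (fun a ha => ?_) C f hf
  refine (injective_iff_map_eq_zero ι).1 hinj a (AddMonoidHom.ext fun r => ?_)
  have := ha r
  rw [AddMonoidHom.comp_apply, AddMonoidHom.eval_apply_apply, hι, one_mul] at this
  simpa using this

end

/-- Characterization: a finite left module `A` over a finite ring `R` has the extension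
property with respect to the symmetrized weight composition built on `Aut_R(A)` iff `A` embeds
in the character module `R̂`. -/
theorem ep_swc_iff_embeds_in_character_module
    (R : Type*) [Ring R] [Finite R] (A : Type*) [AddCommGroup A] [Finite A] [Module R A] :
    HasEPswc R A (⊤ : Subgroup (A ≃ₗ[R] A)) ↔ EmbedsInCharacterModule R A := by
  exact ⟨HasEPswc.embedsInCharacterModule, fun h => h.hasEPswc ⊤⟩
end
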